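/- Let G be a large group, H a finite index normal subgroup of G admitting a surjective homomorphism onto a noncyclic free group, and g₁, …, g_k elements of H. Then the quotient G/⟪g₁ⁿ, …, g_kⁿ⟫^G is large for all but finitely many n ∈ ℕ. -/

import Mathlib

/-- A group is large if some finite index subgroup surjects onto a noncyclic free group. -/
def IsLarge (G : Type*) [Group G] : Prop :=
  ∃ H : Subgroup G, H.FiniteIndex ∧ ∃ φ : H →* FreeGroup (Fin 2), Function.Surjective φ

section Largeness

theorem exists_surjective_of_not_commute {K : Type*} [Group K] (ψ : K →* FreeGroup (Fin 2))
    {a b : K} (hab : ¬ Commute (ψ a) (ψ b)) :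
    ∃ φ : K →* FreeGroup (Fin 2), Function.Surjective φ := by
  classical
  let e := IsFreeGroup.toFreeGroup ψ.range
  have hnt : Nontrivial (IsFreeGroup.Generators ψ.range) := by
    by_contra hsub
    rw [not_nontrivial_iff_subsingleton] at hsub
    have hcomm : ∀ x y : FreeGroup (IsFreeGroup.Generators ψ.range), x * y = y * x := by
      rcases isEmpty_or_nonempty (IsFreeGroup.Generators ψ.range) with hE | ⟨⟨i⟩⟩
      · intro x y
        exact Subsingleton.elim _ _
      · have hz : ∀ x : FreeGroup (IsFreeGroup.Generators ψ.range),
            x ∈ Subgroup.zpowers (FreeGroup.of i) := by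
          intro x
          induction x using FreeGroup.induction_on with
          | C1 => exact one_mem _
          | of j => rw [Subsingleton.elim j i]; exact Subgroup.mem_zpowers _
          | inv_of j hj => exact inv_mem hj
          | mul x y hx hy => exact mul_mem hx hy
        intro x y
        obtain ⟨m, rfl⟩ := hz x
        obtain ⟨n, rfl⟩ := hz y
        exact ((Commute.refl _).zpow_zpow m n).eq
    have h := hcomm (e (ψ.rangeRestrict a)) (e (ψ.rangeRestrict b))
    rw [← map_mul e, ← map_mul e] at h
    exact hab (congrArg Subtype.val (e.injective h))
  obtain ⟨i, j, hij⟩ := hnt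
  let π : FreeGroup (IsFreeGroup.Generators ψ.range) →* FreeGroup (Fin 2) :=
    FreeGroup.map fun k => if k = i then 0 else 1
  have hπ : Function.Surjective π := by
    apply FreeGroup.map_surjective
    intro k
    fin_cases k
    · exact ⟨i, by simp⟩
    · exact ⟨j, by simp [hij.symm]⟩
  exact ⟨π.comp (e.toMonoidHom.comp ψ.rangeRestrict),
    hπ.comp (e.surjective.comp ψ.rangeRestrict_surjective)⟩

theorem isLarge_quotient {G : Type*} [Group G] (N K : Subgroup G) [N.Normal] [K.FiniteIndex]
    (ψ : K →* FreeGroup (Fin 2)) (hψ : ∀ x : K, (x : G) ∈ N → ψ x = 1)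
    {a b : K} (hab : ¬ Commute (ψ a) (ψ b)) : IsLarge (G ⧸ N) := by
  let f := (QuotientGroup.mk' N).subgroupMap K
  have hf : Function.Surjective f := (QuotientGroup.mk' N).subgroupMap_surjective K
  have hker : f.ker ≤ ψ.ker := by
    intro x hx
    apply hψ
    rw [← QuotientGroup.eq_one_iff]
    exact congrArg Subtype.val (MonoidHom.mem_ker.mp hx)
  let ψ' := f.liftOfSurjective hf ⟨ψ, hker⟩
  have hψ' : ∀ x, ψ' (f x) = ψ x := fun x =>
    MonoidHom.liftOfRightInverse_comp_apply f _ _ ⟨ψ, hker⟩ x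
  refine ⟨K.map (QuotientGroup.mk' N), ⟨?_⟩, exists_surjective_of_not_commute ψ' (a := f a)
    (b := f b) (by rwa [hψ', hψ'])⟩
  exact ne_zero_of_dvd_ne_zero Subgroup.FiniteIndex.index_ne_zero
    (K.index_map_dvd (QuotientGroup.mk'_surjective N))

/-- Largeness of a quotient of `G` can be checked on a finite index normal subgroup `H` mapping
to another group `F`, by killing in `F` the images of all conjugates of the relators. -/
theorem isLarge_quotient_normalClosure_pow {G F : Type*} [Group G] [Group F] (H : Subgroup G)
    [H.Normal] [H.FiniteIndex] (φ : H →* F) (hφ : Function.Surjective φ) {ι : Type*} (g : ι → H)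
    (n : ℕ) (M K : Subgroup F) [M.Normal] [K.FiniteIndex]
    (ψ : K →* FreeGroup (Fin 2)) (hψ : ∀ x : K, (x : F) ∈ M → ψ x = 1)
    {a b : K} (hab : ¬ Commute (ψ a) (ψ b))
    (hM : ∀ (i : ι) (q : G ⧸ H), φ (MulAut.conjNormal q.out (g i)) ^ n ∈ M) :
    IsLarge (G ⧸ Subgroup.normalClosure {x | ∃ i, x = (g i : G) ^ n}) := by
  let L := (K.comap φ).map H.subtype
  have hL : L.FiniteIndex := by
    constructor
    rw [Subgroup.index_map_subtype, Subgroup.index_comap_of_surjective _ hφ]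
    exact mul_ne_zero Subgroup.FiniteIndex.index_ne_zero Subgroup.FiniteIndex.index_ne_zero
  have hconj : ∀ (x : G) (i : ι), x * (g i : G) ^ n * x⁻¹ ∈ (M.comap φ).map H.subtype := by
    intro x i
    have hh : (x * (x : G ⧸ H).out⁻¹) ∈ H := by
      rw [← div_eq_mul_inv, ← QuotientGroup.eq_iff_div_mem]
      exact (QuotientGroup.out_eq' _).symm
    refine ⟨⟨_, hh⟩ * MulAut.conjNormal (x : G ⧸ H).out (g i) ^ n * ⟨_, hh⟩⁻¹, ?_, ?_⟩
    · exact (inferInstance : (M.comap φ).Normal).conj_mem _ (by simpa using hM i x) _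
    · simp only [conj_pow, map_mul, map_pow, map_inv, Subgroup.subtype_apply,
        MulAut.conjNormal_apply]
      group
  have hN : Subgroup.normalClosure {x | ∃ i, x = (g i : G) ^ n} ≤
      (M.comap φ).map H.subtype := by
    rw [Subgroup.normalClosure, Subgroup.closure_le]
    intro y hy
    obtain ⟨z, ⟨i, rfl⟩, hz⟩ := Group.mem_conjugatesOfSet_iff.mp hy
    obtain ⟨x, rfl⟩ := isConj_iff.mp hz
    exact hconj x i
  let e := (K.comap φ).equivMapOfInjective H.subtype H.subtype_injective
  refine isLarge_quotient _ L
    ((ψ.comp (φ.subgroupComap K)).comp e.symm.toMonoidHom) ?_ (a := e ⟨(hφ a).choose, ?_⟩)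
    (b := e ⟨(hφ b).choose, ?_⟩) ?_
  · intro x hx
    obtain ⟨y, rfl⟩ := e.surjective x
    obtain ⟨z, hz, hzy⟩ := hN hx
    simp only [MonoidHom.comp_apply, MulEquiv.coe_toMonoidHom, MulEquiv.symm_apply_apply]
    apply hψ
    have : z = y := H.subtype_injective hzy
    subst this
    exact hz
  · simp [(hφ a).choose_spec]
  · simp [(hφ b).choose_spec]
  · have h1 : φ.subgroupComap K ⟨(hφ a).choose, by simp [(hφ a).choose_spec]⟩ = a :=
      Subtype.ext (hφ a).choose_spec
    have h2 : φ.subgroupComap K ⟨(hφ b).choose, by simp [(hφ b).choose_spec]⟩ = b :=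
      Subtype.ext (hφ b).choose_spec
    simpa [h1, h2] using hab

end Largeness

section FiniteQuotients

open Matrix Polynomial

/-- The homomorphism from the free group of rank two to `GL₂(R)` sending the generators to the
elementary matrices with off-diagonal entry `t`. -/
def FreeGroup.toGL₂ {R : Type*} [CommRing R] (t : R) :
    FreeGroup (Fin 2) →* (Matrix (Fin 2) (Fin 2) R)ˣ :=
  FreeGroup.lift ![⟨!![1, t; 0, 1], !![1, -t; 0, 1], by simp [Matrix.one_fin_two],
    by simp [Matrix.one_fin_two]⟩, ⟨!![1, 0; t, 1], !![1, 0; -t, 1], by simp [Matrix.one_fin_two],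
    by simp [Matrix.one_fin_two]⟩]

theorem FreeGroup.mapMatrix_toGL₂ {R S : Type*} [CommRing R] [CommRing S] (f : R →+* S) (t : R)
    (g : FreeGroup (Fin 2)) : f.mapMatrix (toGL₂ t g).val = (toGL₂ (f t) g).val := by
  have h : (Units.map (f.mapMatrix (m := Fin 2)).toMonoidHom).comp (toGL₂ t) = toGL₂ (f t) := by
    refine FreeGroup.ext_hom _ _ fun k => Units.ext ?_
    ext a b
    fin_cases k <;> fin_cases a <;> fin_cases b <;> simp [toGL₂]
  rw [← h]
  rfl

theorem FreeGroup.toGL₂_eq_one_add_smul {R : Type*} [CommRing R] (t : R) (g : FreeGroup (Fin 2)) :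
    ∃ Y : Matrix (Fin 2) (Fin 2) R, (toGL₂ t g).val = 1 + t • Y := by
  have hzero : toGL₂ (0 : R ⧸ Ideal.span {t}) = 1 := by
    refine FreeGroup.ext_hom _ _ fun k => Units.ext ?_
    fin_cases k <;> simp [toGL₂, Matrix.one_fin_two]
  have hmap : (Ideal.Quotient.mk (Ideal.span {t})).mapMatrix ((toGL₂ t g).val - 1) = 0 := by
    rw [map_sub, FreeGroup.mapMatrix_toGL₂,
      Ideal.Quotient.eq_zero_iff_mem.mpr (Ideal.mem_span_singleton_self t), hzero]
    simp
  have hdvd : ∀ i j, t ∣ ((toGL₂ t g).val - 1) i j := by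
    intro i j
    rw [← Ideal.mem_span_singleton, ← Ideal.Quotient.eq_zero_iff_mem]
    exact congrFun (congrFun hmap i) j
  choose Y hY using hdvd
  refine ⟨Matrix.of Y, ?_⟩
  rw [← sub_eq_iff_eq_add']
  ext i j
  exact hY i j

/-- Ping-pong with the elementary matrices with off-diagonal entry `3`. -/
theorem FreeGroup.toGL₂_three_ne_one {g : FreeGroup (Fin 2)} (hg : g ≠ 1) :
    toGL₂ (3 : ℤ) g ≠ 1 := by
  have key : ∀ l : List (Fin 2 × Bool), FreeGroup.IsReduced l → ∀ p q : ℤ,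
      (toGL₂ (3 : ℤ) (FreeGroup.mk l)).val *ᵥ ![1, 1] = ![p, q] →
      match l with
      | [] => p = 1 ∧ q = 1
      | (0, true) :: _ => 0 < p * q ∧ q ^ 2 < p ^ 2
      | (0, false) :: _ => p * q < 0 ∧ q ^ 2 < p ^ 2
      | (1, true) :: _ => 0 < p * q ∧ p ^ 2 < q ^ 2
      | (1, false) :: _ => p * q < 0 ∧ p ^ 2 < q ^ 2 := by
    intro l
    induction l with
    | nil =>
      intro _ p q h
      rw [← FreeGroup.one_eq_mk] at h
      simpa [eq_comm] using h
    | cons x l ih =>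
      intro hl p q h
      have hl' : FreeGroup.IsReduced l := hl.infix (List.suffix_cons x l).isInfix
      obtain ⟨p', q', hpq⟩ : ∃ p' q' : ℤ,
          (toGL₂ (3 : ℤ) (FreeGroup.mk l)).val *ᵥ ![1, 1] = ![p', q'] :=
        ⟨_, _, by ext i; fin_cases i <;> rfl⟩
      have ih' := ih hl' p' q' hpq
      rw [← List.singleton_append, ← FreeGroup.mul_mk, _root_.map_mul, Units.val_mul,
        ← Matrix.mulVec_mulVec, hpq] at h
      have hx : (toGL₂ (3 : ℤ) (FreeGroup.mk [x])).val =
          match x with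
          | (0, true) => !![1, 3; 0, 1]
          | (0, false) => !![1, -3; 0, 1]
          | (1, true) => !![1, 0; 3, 1]
          | (1, false) => !![1, 0; -3, 1] := by
        obtain ⟨i, b⟩ := x
        fin_cases i <;> cases b <;> simp [toGL₂]
      rw [hx] at h
      have h₀ := congrFun h 0
      have h₁ := congrFun h 1
      rcases l with _ | ⟨⟨k, c⟩, l⟩
      · obtain ⟨i, b⟩ := x
        obtain ⟨rfl, rfl⟩ := ih'
        fin_cases i <;> cases b <;> simp [Matrix.mulVec, dotProduct] at h₀ h₁ ⊢ <;>
          subst h₀ h₁ <;> norm_num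
      · obtain ⟨i, b⟩ := x
        have hxy := (FreeGroup.isReduced_cons_cons.mp hl).1
        fin_cases i <;> cases b <;> fin_cases k <;> cases c <;>
          simp [Matrix.mulVec, dotProduct] at h₀ h₁ ih' hxy ⊢ <;> subst h₀ h₁ <;>
          obtain ⟨h₂, h₃⟩ := ih' <;> constructor <;> nlinarith
  obtain ⟨l, hl⟩ : ∃ l, l = g.toWord := ⟨_, rfl⟩
  intro h
  have hk := key l (hl ▸ FreeGroup.isReduced_toWord) 1 1 (by
    rw [hl, FreeGroup.mk_toWord, h]; simp)
  rcases l with _ | ⟨⟨i, b⟩, l⟩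
  · exact hg (FreeGroup.toWord_eq_nil_iff.mp hl.symm)
  · fin_cases i <;> cases b <;> simp at hk

theorem Nat.dvd_choose_of_lt {n k c : ℕ} (hk : 0 < k) (hkc : k < c) :
    n / n.gcd (c - 1).factorial ∣ n.choose k := by
  rcases n.eq_zero_or_pos with rfl | hn
  · simp [Nat.choose_eq_zero_of_lt hk]
  obtain ⟨n, rfl⟩ := Nat.exists_eq_succ_of_ne_zero hn.ne'
  obtain ⟨k, rfl⟩ := Nat.exists_eq_succ_of_ne_zero hk.ne'
  have h : (n + 1) ∣ (c - 1).factorial * (n + 1).choose (k + 1) := by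
    have hk' : (k + 1) ∣ (c - 1).factorial := Nat.dvd_factorial (by omega) (by omega)
    obtain ⟨m, hm⟩ := hk'
    rw [hm]
    exact ⟨m * n.choose k, by linear_combination m * (Nat.add_one_mul_choose_eq n k).symm⟩
  have hpos : 0 < (n + 1).gcd (c - 1).factorial := Nat.gcd_pos_of_pos_left _ n.succ_pos
  refine (Nat.coprime_div_gcd_div_gcd hpos).dvd_of_dvd_mul_left ?_
  refine Nat.dvd_of_mul_dvd_mul_left hpos ?_
  rwa [Nat.mul_div_cancel' (Nat.gcd_dvd_left _ _), ← mul_assoc,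
    Nat.mul_div_cancel' (Nat.gcd_dvd_right _ _)]

theorem one_add_smul_pow_eq_one {S : Type*} [CommRing S] {t : S} {c n : ℕ} (ht : t ^ c = 0)
    (hc : ∀ k, 0 < k → k < c → (n.choose k : S) = 0) (Y : Matrix (Fin 2) (Fin 2) S) :
    (1 + t • Y) ^ n = 1 := by
  rw [add_comm, (Commute.one_right _).add_pow, Finset.sum_eq_single 0]
  · simp
  · intro k _ hk
    rcases lt_or_ge k c with hkc | hkc
    · have : ((n.choose k : ℕ) : Matrix (Fin 2) (Fin 2) S) = 0 := by
        have h := congrArg (algebraMap S (Matrix (Fin 2) (Fin 2) S)) (hc k (by omega) hkc)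
        simpa using h
      rw [this, mul_zero]
    · rw [_root_.smul_pow, pow_eq_zero_of_le hkc ht]
      simp
  · simp

/-- The free group of rank two is residually a finite group of exponent dividing `n`, for all
large `n`. -/
theorem FreeGroup.exists_normal_pow_mem_notMem {v : FreeGroup (Fin 2)} (hv : v ≠ 1) :
    ∃ n₀ : ℕ, ∀ n ≥ n₀, ∃ N : Subgroup (FreeGroup (Fin 2)), N.Normal ∧ N.FiniteIndex ∧
      (∀ g, g ^ n ∈ N) ∧ v ∉ N := by
  obtain ⟨i, j, hij⟩ : ∃ i j, ((toGL₂ (X : ℤ[X]) v).val - 1) i j ≠ 0 := by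
    by_contra! h
    have h1 : (toGL₂ (X : ℤ[X]) v).val = 1 := sub_eq_zero.mp (Matrix.ext h)
    apply toGL₂_three_ne_one hv
    have h3 := FreeGroup.mapMatrix_toGL₂ (Polynomial.evalRingHom (3 : ℤ)) X v
    rw [h1, _root_.map_one] at h3
    exact Units.ext (by simpa using h3.symm)
  set f : ℤ[X] := ((toGL₂ (X : ℤ[X]) v).val - 1) i j with hf
  have hf0 : f ≠ 0 := hij
  set c := f.natDegree + 1 with hc
  refine ⟨(c - 1).factorial * (f.leadingCoeff.natAbs + 1), fun n hn => ?_⟩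
  set m := n / n.gcd (c - 1).factorial with hm
  have hn0 : 0 < n := lt_of_lt_of_le (by positivity) hn
  have hmlt : f.leadingCoeff.natAbs < m := by
    rw [hm, Nat.lt_div_iff_mul_lt_of_dvd (Nat.gcd_pos_of_pos_left _ hn0).ne' (Nat.gcd_dvd_left _ _)]
    have := Nat.le_of_dvd (Nat.factorial_pos (c - 1)) (Nat.gcd_dvd_right n (c - 1).factorial)
    have hpos := Nat.factorial_pos (c - 1)
    nlinarith
  have : NeZero m := ⟨by omega⟩
  have : Fact (1 < m) := ⟨by have := Int.natAbs_pos.mpr (leadingCoeff_ne_zero.mpr hf0); omega⟩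
  let S := AdjoinRoot (X ^ c : (ZMod m)[X])
  have hmonic : (X ^ c : (ZMod m)[X]).Monic := monic_X_pow c
  have : Module.Finite (ZMod m) S := hmonic.finite_adjoinRoot
  have : Finite S := Module.finite_of_finite (ZMod m)
  let t : S := AdjoinRoot.root _
  have ht : t ^ c = 0 := by
    have := AdjoinRoot.eval₂_root (X ^ c : (ZMod m)[X])
    simpa using this
  let ρ : ℤ[X] →+* S := (AdjoinRoot.mk _).comp (Polynomial.mapRingHom (Int.castRingHom (ZMod m)))
  have hρX : ρ X = t := by simp [ρ, t]
  refine ⟨(toGL₂ t).ker, inferInstance, inferInstance, fun g => ?_, fun hmem => ?_⟩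
  · rw [MonoidHom.mem_ker, map_pow]
    obtain ⟨Y, hY⟩ := toGL₂_eq_one_add_smul t g
    apply Units.ext
    rw [Units.val_pow_eq_pow_val, hY]
    refine one_add_smul_pow_eq_one ht (fun k hk hkc => ?_) Y
    have h := (ZMod.natCast_eq_zero_iff (n.choose k) m).mpr (Nat.dvd_choose_of_lt hk hkc)
    have h' := congrArg (algebraMap (ZMod m) S) h
    simpa using h'
  · rw [MonoidHom.mem_ker] at hmem
    have h0 : ρ f = 0 := by
      have h : ρ.mapMatrix ((toGL₂ (X : ℤ[X]) v).val - 1) = 0 := by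
        rw [map_sub, FreeGroup.mapMatrix_toGL₂, hρX, hmem]
        simp
      exact congrFun (congrFun h i) j
    have hdvd : (X ^ c : (ZMod m)[X]) ∣ f.map (Int.castRingHom (ZMod m)) := by
      rw [← AdjoinRoot.mk_eq_zero]
      exact h0
    have hcoeff := (X_pow_dvd_iff.mp hdvd) f.natDegree (by omega)
    rw [coeff_map, eq_intCast, ZMod.intCast_zmod_eq_zero_iff_dvd] at hcoeff
    have := Nat.le_of_dvd (Int.natAbs_pos.mpr (leadingCoeff_ne_zero.mpr hf0))
      (Int.natCast_dvd.mp hcoeff)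
    omega

theorem FreeGroup.exists_normal_pow_mem_forall_notMem (s : Finset (FreeGroup (Fin 2)))
    (hs : (1 : FreeGroup (Fin 2)) ∉ s) :
    ∃ n₀ : ℕ, ∀ n ≥ n₀, ∃ N : Subgroup (FreeGroup (Fin 2)), N.Normal ∧ N.FiniteIndex ∧
      (∀ g, g ^ n ∈ N) ∧ ∀ v ∈ s, v ∉ N := by
  classical
  induction s using Finset.induction_on with
  | empty => exact ⟨0, fun n _ => ⟨⊤, inferInstance, inferInstance, by simp, by simp⟩⟩
  | insert v s _ ih =>
    rw [Finset.mem_insert, not_or] at hs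
    obtain ⟨n₁, h₁⟩ := FreeGroup.exists_normal_pow_mem_notMem (Ne.symm hs.1)
    obtain ⟨n₂, h₂⟩ := ih hs.2
    refine ⟨max n₁ n₂, fun n hn => ?_⟩
    obtain ⟨N₁, hN₁, hF₁, hp₁, hv₁⟩ := h₁ n (le_of_max_le_left hn)
    obtain ⟨N₂, hN₂, hF₂, hp₂, hv₂⟩ := h₂ n (le_of_max_le_right hn)
    refine ⟨N₁ ⊓ N₂, inferInstance, inferInstance, fun g => ⟨hp₁ g, hp₂ g⟩, ?_⟩
    rw [Finset.forall_mem_insert]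
    exact ⟨fun h => hv₁ h.1, fun w hw h => hv₂ w hw h.2⟩

end FiniteQuotients

section Cocycles

/-- A cocycle of the action of `G` on `X` with values in the group `A`. -/
structure ActionCocycle (G X A : Type*) [Group G] [MulAction G X] [Group A] where
  /-- The underlying function. -/
  toFun : G → X → A
  map_mul' : ∀ g h x, toFun (g * h) x = toFun g (h • x) * toFun h x

namespace ActionCocycle

variable {G X A B : Type*} [Group G] [MulAction G X] [Group A] [Group B]

instance : CoeFun (ActionCocycle G X A) fun _ => G → X → A := ⟨toFun⟩

variable (c : ActionCocycle G X A)

theorem map_mul (g h : G) (x : X) : c (g * h) x = c g (h • x) * c h x := c.map_mul' g h x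

theorem map_one (x : X) : c 1 x = 1 := by
  have h := c.map_mul 1 1 x
  simpa using h

theorem map_inv (g : G) (x : X) : c g⁻¹ x = (c g (g⁻¹ • x))⁻¹ := by
  rw [eq_inv_iff_mul_eq_one, ← inv_smul_smul g⁻¹ (g⁻¹ • x), inv_inv]
  have h := c.map_mul g⁻¹ g (g⁻¹ • x)
  rw [inv_mul_cancel, c.map_one, smul_inv_smul] at h
  simpa using h.symm

theorem map_pow_of_smul_eq {g : G} {x : X} (h : g • x = x) (n : ℕ) : c (g ^ n) x = c g x ^ n := by
  induction n with
  | zero => simpa using c.map_one x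
  | succ n ih => rw [pow_succ, c.map_mul, h, ih, pow_succ]

theorem map_conj_of_smul_eq {g : G} {x : X} (h : g • x = x) (k : G) :
    c (k * g * k⁻¹) (k • x) = c k x * c g x * (c k x)⁻¹ := by
  rw [c.map_mul, c.map_mul, c.map_inv, inv_smul_smul, h]

/-- The cocycle obtained by applying a homomorphism to the values. -/
def map (f : A →* B) : ActionCocycle G X B where
  toFun g x := f (c g x)
  map_mul' g h x := by rw [c.map_mul, _root_.map_mul]

@[simp] theorem map_apply (f : A →* B) (g : G) (x : X) : c.map f g x = f (c g x) := rfl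

/-- The product of `X` and `A`, on which `G` acts through the cocycle `c`. -/
def SkewProduct (_ : ActionCocycle G X A) : Type _ := X × A

instance : MulAction G c.SkewProduct where
  smul g y := (g • y.1, c g y.1 * y.2)
  one_smul y := Prod.ext (one_smul G y.1) (by
    change c 1 y.1 * y.2 = y.2
    rw [c.map_one, one_mul])
  mul_smul g h y := Prod.ext (mul_smul g h y.1) (by
    change c (g * h) y.1 * y.2 = c g (h • y.1) * (c h y.1 * y.2)
    rw [c.map_mul, mul_assoc])

/-- The restriction of a cocycle to the stabilizer of a point. -/
def stabilizerHom (x : X) : MulAction.stabilizer G x →* A where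
  toFun g := c g x
  map_one' := c.map_one x
  map_mul' g h := by
    change c (g * h) x = c g x * c h x
    rw [c.map_mul, MulAction.mem_stabilizer_iff.mp h.2]

/-- The elements acting trivially on `X` at which the cocycle vanishes. -/
def ker : Subgroup G := (MulAction.toPermHom G c.SkewProduct).ker

instance : c.ker.Normal := inferInstanceAs (MulAction.toPermHom G c.SkewProduct).ker.Normal

theorem mem_ker_iff {g : G} : g ∈ c.ker ↔ ∀ x, g • x = x ∧ c g x = 1 := by
  rw [ker, MonoidHom.mem_ker, Equiv.ext_iff]
  constructor
  · intro h x
    have hx := Prod.ext_iff.mp (h (x, 1))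
    exact ⟨hx.1, (mul_one _).symm.trans hx.2⟩
  · intro h y
    exact Prod.ext (h y.1).1 (by
      change c g y.1 * y.2 = y.2
      rw [(h y.1).2, one_mul])

section Free

variable {ι : Type*} [MulAction (FreeGroup ι) X]

theorem eq_of_apply_of_eq {c d : ActionCocycle (FreeGroup ι) X A}
    (h : ∀ i x, c (FreeGroup.of i) x = d (FreeGroup.of i) x) (g : FreeGroup ι) (x : X) :
    c g x = d g x := by
  induction g using FreeGroup.induction_on generalizing x with
  | C1 => rw [c.map_one, d.map_one]
  | of i => exact h i x
  | inv_of i _ => rw [c.map_inv, d.map_inv, h]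
  | mul a b ha hb => rw [c.map_mul, d.map_mul, ha, hb]

theorem exists_apply_of_eq (α : ι → X → A) :
    ∃ c : ActionCocycle (FreeGroup ι) X A, ∀ i x, c (FreeGroup.of i) x = α i x := by
  let ρ : FreeGroup ι →* Equiv.Perm (X × A) := FreeGroup.lift fun i =>
    { toFun := fun y => (FreeGroup.of i • y.1, α i y.1 * y.2)
      invFun := fun y => ((FreeGroup.of i)⁻¹ • y.1, (α i ((FreeGroup.of i)⁻¹ • y.1))⁻¹ * y.2)
      left_inv := fun y => by simp
      right_inv := fun y => by simp }
  have hof : ∀ i y, ρ (FreeGroup.of i) y = (FreeGroup.of i • y.1, α i y.1 * y.2) := by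
    intro i y
    simp only [ρ, FreeGroup.lift_apply_of]
    rfl
  have hρ : ∀ (g : FreeGroup ι) (x : X) (b : A),
      ρ g (x, b) = (g • x, (ρ g (x, 1)).2 * b) := by
    intro g
    induction g using FreeGroup.induction_on with
    | C1 => simp
    | of i => simp [hof]
    | inv_of i _ =>
      intro x b
      simp only [_root_.map_inv]
      rw [Equiv.Perm.inv_eq_iff_eq, hof]
      have h1 := hof i ((ρ (FreeGroup.of i))⁻¹ (x, 1))
      rw [← Equiv.Perm.mul_apply, mul_inv_cancel, Equiv.Perm.one_apply, Prod.ext_iff] at h1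
      obtain ⟨h1, h2⟩ := h1
      have h3 : ((ρ (FreeGroup.of i))⁻¹ (x, 1)).1 = (FreeGroup.of i)⁻¹ • x := by
        rw [eq_inv_smul_iff]
        exact h1.symm
      rw [h3] at h2
      refine Prod.ext (by simp) ?_
      simp only [← mul_assoc]
      replace h2 : 1 = α i ((FreeGroup.of i)⁻¹ • x) * ((ρ (FreeGroup.of i))⁻¹ (x, 1)).2 := h2
      rw [← h2, one_mul]
    | mul a b ha hb =>
      intro x y
      simp only [_root_.map_mul, Equiv.Perm.mul_apply]
      rw [hb x y, hb x 1, ha, ha (b • x) (_ * 1)]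
      simp [mul_smul, mul_assoc]
  refine ⟨⟨fun g x => (ρ g (x, 1)).2, fun g h x => ?_⟩, fun i x => ?_⟩
  · rw [_root_.map_mul, Equiv.Perm.mul_apply, hρ h x 1, hρ g]
  · change (ρ (FreeGroup.of i) (x, 1)).2 = _
    simp [hof]

end Free

end ActionCocycle

end Cocycles

section Flows

theorem exists_ne_zero_forall_sum_mul_eq_zero {V C : Type*} [Fintype V] [Fintype C]
    (h : Fintype.card C < Fintype.card V) (M : C → V → ℤ) :
    ∃ α : V → ℤ, α ≠ 0 ∧ ∀ c, ∑ v, M c v * α v = 0 := by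
  rcases isEmpty_or_nonempty C with hC | hC
  · have : Nonempty V := Fintype.card_pos_iff.mp (by omega)
    exact ⟨1, one_ne_zero, fun c => isEmptyElim c⟩
  · obtain ⟨α, hα, h0, -⟩ :=
      Int.Matrix.exists_ne_zero_int_vec_norm_le (Matrix.of M) h Fintype.card_pos
    exact ⟨α, hα, fun c => congrFun h0 c⟩

theorem card_orbits_zpowers_mul_le {G X : Type*} [Group G] [MulAction G X] [Finite X] (w : G)
    (r : ℕ) (hw : ∀ x : X, ∀ j, 1 ≤ j → j ≤ r → w ^ j • x ≠ x) :
    Nat.card (MulAction.orbitRel.Quotient (Subgroup.zpowers w) X) * (r + 1) ≤ Nat.card X := by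
  have hinj : Function.Injective
      fun p : MulAction.orbitRel.Quotient (Subgroup.zpowers w) X × Fin (r + 1) =>
        w ^ (p.2 : ℕ) • p.1.out := by
    rintro ⟨o, i⟩ ⟨o', j⟩ h
    have hmk : ∀ (o : MulAction.orbitRel.Quotient (Subgroup.zpowers w) X) (j : ℕ),
        (Quotient.mk _ (w ^ j • o.out) : MulAction.orbitRel.Quotient (Subgroup.zpowers w) X)
          = o := by
      intro o j
      conv_rhs => rw [← o.out_eq]
      exact Quotient.sound ⟨⟨w ^ j, Subgroup.npow_mem_zpowers w j⟩, rfl⟩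
    have ho : o = o' := by
      rw [← hmk o i, ← hmk o' j]
      exact congrArg _ h
    subst ho
    have hle : ∀ i j : Fin (r + 1), w ^ (i : ℕ) • o.out = w ^ (j : ℕ) • o.out → ¬ i < j := by
      intro i j h hij
      refine hw o.out (j - i) (Nat.sub_pos_of_lt hij) (by omega) ?_
      rw [pow_sub _ (le_of_lt hij), (Commute.refl w).pow_pow _ _ |>.inv_right.eq, mul_smul, ← h,
        inv_smul_smul]
    exact Prod.ext rfl (le_antisymm (not_lt.mp (hle j i h.symm)) (not_lt.mp (hle i j h)))
  rw [← Nat.card_fin (r + 1), ← Nat.card_prod]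
  exact Nat.card_le_card_of_injective _ hinj

/-- A finite `FreeGroup (Fin 2)`-set carries a nonzero integral flow vanishing near a small set
`B`, whose associated cocycle vanishes on finitely many elements with long orbits. -/
theorem exists_flow {X κ : Type*} [MulAction (FreeGroup (Fin 2)) X] [Fintype X] [Fintype κ]
    (w : κ → FreeGroup (Fin 2)) (n : ℕ) (hn : ∀ k (x : X), w k ^ n • x = x)
    (hw : ∀ k (x : X) j, 1 ≤ j → j ≤ Fintype.card κ → w k ^ j • x ≠ x)
    (B : Finset X) (hB : 2 * (Fintype.card κ + 1) * B.card < Fintype.card X) :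
    ∃ α : Fin 2 × X → ℤ, α ≠ 0 ∧ (∀ i, ∀ x ∈ B, α (i, x) = 0) ∧
      (∀ f : X → ℤ, ∑ v, α v * (f (FreeGroup.of v.1 • v.2) - f v.2) = 0) ∧
      ∀ c : ActionCocycle (FreeGroup (Fin 2)) X (Multiplicative ℤ),
        (∀ i x, c (FreeGroup.of i) x = Multiplicative.ofAdd (α (i, x))) →
        ∀ k x, c (w k ^ n) x = 1 := by
  classical
  let Ω : κ → Type _ := fun k => MulAction.orbitRel.Quotient (Subgroup.zpowers (w k)) X
  have : ∀ k, Fintype (Ω k) := fun k => Fintype.ofFinite _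
  obtain ⟨E, hE⟩ := ActionCocycle.exists_apply_of_eq (ι := Fin 2) (X := X)
    (A := Multiplicative (Fin 2 × X → ℤ)) fun i x => Multiplicative.ofAdd (Pi.single (i, x) 1)
  have hcard : Fintype.card ((Σ k, Ω k) ⊕ X ⊕ (Fin 2 × B)) < Fintype.card (Fin 2 × X) := by
    have hΩ : (∑ k, Fintype.card (Ω k)) * (Fintype.card κ + 1)
        ≤ Fintype.card κ * Fintype.card X := by
      rw [Finset.sum_mul]
      refine (Finset.sum_le_card_nsmul _ _ (Fintype.card X) fun k _ => ?_).trans (by simp)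
      have h := card_orbits_zpowers_mul_le (w k) (Fintype.card κ) (hw k)
      rwa [Nat.card_eq_fintype_card, Nat.card_eq_fintype_card] at h
    simp only [Fintype.card_sum, Fintype.card_sigma, Fintype.card_prod, Fintype.card_fin,
      Fintype.card_coe]
    nlinarith
  obtain ⟨α, hα, h⟩ := exists_ne_zero_forall_sum_mul_eq_zero hcard
    (Sum.elim (fun p v => Multiplicative.toAdd (E (w p.1 ^ n) p.2.out) v)
      (Sum.elim (fun y v => (if FreeGroup.of v.1 • v.2 = y then 1 else 0) -
        (if v.2 = y then 1 else 0)) fun p => Pi.single (p.1, (p.2 : X)) 1))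
  refine ⟨α, hα, fun i x hx => ?_, fun f => ?_, fun c hc k x => ?_⟩
  · simpa [Pi.single_apply] using h (.inr (.inr (i, ⟨x, hx⟩)))
  · have h1 : ∀ y, ∑ v : Fin 2 × X, ((if FreeGroup.of v.1 • v.2 = y then 1 else 0) -
        (if v.2 = y then 1 else 0)) * α v = 0 := fun y => h (.inr (.inl y))
    calc ∑ v, α v * (f (FreeGroup.of v.1 • v.2) - f v.2)
        = ∑ v, ∑ y, f y * (((if FreeGroup.of v.1 • v.2 = y then 1 else 0) -
          (if v.2 = y then 1 else 0)) * α v) := by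
          refine Finset.sum_congr rfl fun v _ => ?_
          simp [mul_sub, Finset.sum_sub_distrib, mul_comm]
      _ = 0 := by
          rw [Finset.sum_comm]
          simp only [← Finset.mul_sum, h1, mul_zero, Finset.sum_const_zero]
  · let dot : Multiplicative (Fin 2 × X → ℤ) →* Multiplicative ℤ :=
      AddMonoidHom.toMultiplicative
        { toFun := fun e => ∑ v, e v * α v
          map_zero' := by simp
          map_add' := by simp [add_mul, Finset.sum_add_distrib] }
    have hdot : ∀ g x, c g x = E.map dot g x := by
      refine ActionCocycle.eq_of_apply_of_eq fun i x => ?_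
      rw [hc, ActionCocycle.map_apply, hE]
      simp [dot, Pi.single_apply]
    obtain ⟨⟨_, m, rfl⟩, hm⟩ : ∃ z : Subgroup.zpowers (w k), z • (Quotient.mk _ x : Ω k).out = x :=
      MulAction.orbitRel_apply.mp
        ((MulAction.orbitRel (Subgroup.zpowers (w k)) X).symm (Quotient.mk_out x))
    replace hm : w k ^ m • (Quotient.mk _ x : Ω k).out = x := hm
    have h2 := c.map_conj_of_smul_eq (hn k (Quotient.mk _ x : Ω k).out) (w k ^ m)
    rw [((Commute.refl (w k)).zpow_left m |>.pow_right n).eq, mul_inv_cancel_right, hm] at h2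
    rw [h2, hdot (w k ^ n)]
    have h3 : dot (E (w k ^ n) (Quotient.mk _ x : Ω k).out) = 1 :=
      congrArg Multiplicative.ofAdd (h (.inl ⟨k, Quotient.mk _ x⟩))
    rw [ActionCocycle.map_apply, h3, mul_one, mul_inv_cancel]

/-- If a cocycle is given by powers of `u` along the support of a nonzero flow, then some loop
has a nonzero power of `u` as its value. -/
theorem ActionCocycle.exists_loop_of_flow {X A : Type*} [MulAction (FreeGroup (Fin 2)) X]
    [Fintype X] [Group A] (c : ActionCocycle (FreeGroup (Fin 2)) X A) (u : A)
    (α : Fin 2 × X → ℤ) (hα : α ≠ 0)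
    (hf : ∀ f : X → ℤ, ∑ v, α v * (f (FreeGroup.of v.1 • v.2) - f v.2) = 0)
    (hc : ∀ i x, α (i, x) ≠ 0 → c (FreeGroup.of i) x = u ^ α (i, x)) :
    ∃ g y, ∃ m : ℤ, m ≠ 0 ∧ g • y = y ∧ c g y = u ^ m := by
  by_contra! hno
  let S : Setoid X :=
    { r := fun x y => ∃ g, ∃ k : ℤ, g • x = y ∧ c g x = u ^ k
      iseqv := ⟨fun x => ⟨1, 0, one_smul _ _, by rw [c.map_one, zpow_zero]⟩, by
        rintro x _ ⟨g, k, rfl, hk⟩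
        exact ⟨g⁻¹, -k, inv_smul_smul _ _, by rw [c.map_inv, inv_smul_smul, hk, zpow_neg]⟩, by
        rintro x _ _ ⟨g, k, rfl, hk⟩ ⟨h, l, rfl, hl⟩
        exact ⟨h * g, l + k, mul_smul _ _ _, by rw [c.map_mul, hk, hl, zpow_add]⟩⟩ }
  have hrel : ∀ x : X, ∃ g, ∃ k : ℤ, g • (Quotient.mk S x).out = x ∧
      c g (Quotient.mk S x).out = u ^ k := fun x => Quotient.mk_out (s := S) x
  choose p f hp hpf using hrel
  have hdiff : ∀ v, α v ≠ 0 → α v = f (FreeGroup.of v.1 • v.2) - f v.2 := by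
    rintro ⟨i, x⟩ hv
    by_contra hne
    have hq : Quotient.mk S (FreeGroup.of i • x) = Quotient.mk S x :=
      (Quotient.sound (s := S) ⟨_, _, rfl, hc i x hv⟩).symm
    have h1 := hp (FreeGroup.of i • x)
    have h2 := hpf (FreeGroup.of i • x)
    rw [hq] at h1 h2
    refine hno ((p (FreeGroup.of i • x))⁻¹ * FreeGroup.of i * p x) (Quotient.mk S x).out
      (-f (FreeGroup.of i • x) + α (i, x) + f x) (fun h0 => hne (by dsimp only; omega)) ?_ ?_
    · rw [mul_smul, mul_smul, hp, inv_smul_eq_iff, h1]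
    · have h3 : (p (FreeGroup.of i • x))⁻¹ • FreeGroup.of i • x = (Quotient.mk S x).out := by
        rw [inv_smul_eq_iff, h1]
      rw [c.map_mul, c.map_mul, hp, c.map_inv, h3, h2, hc i x hv, hpf, zpow_add, zpow_add, zpow_neg]
  apply hα
  have hsum : ∑ v, α v * α v = 0 := by
    rw [← hf f]
    refine Finset.sum_congr rfl fun v _ => ?_
    by_cases hv : α v = 0
    · simp [hv]
    · rw [← hdiff v hv]
  rw [Finset.sum_eq_zero_iff_of_nonneg fun v _ => mul_self_nonneg _] at hsum
  exact funext fun v => mul_self_eq_zero.mp (hsum v (Finset.mem_univ v))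

end Flows

section CyclicCovers

theorem FreeGroup.not_commute_of_zpow {v : FreeGroup (Fin 2)} {m : ℤ} (hm : m ≠ 0)
    (hv : FreeGroup.lift ![1, Multiplicative.ofAdd (1 : ℤ)] v ≠ 1) :
    ¬ Commute (FreeGroup.of 0 ^ m) v := by
  let ρ : FreeGroup (Fin 2) →* Equiv.Perm ℚ :=
    FreeGroup.lift ![Equiv.addRight 1, Equiv.mulRight₀ 2 two_ne_zero]
  have hρ : ∀ g, ∃ b : ℚ, ∀ x, ρ g x = (2 : ℚ) ^ Multiplicative.toAdd
      (FreeGroup.lift ![1, Multiplicative.ofAdd (1 : ℤ)] g) * x + b := by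
    intro g
    induction g using FreeGroup.induction_on with
    | C1 => exact ⟨0, by simp⟩
    | of i => fin_cases i <;> [exact ⟨1, by simp [ρ]⟩; exact ⟨0, by simp [ρ, mul_comm]⟩]
    | inv_of i _ =>
      fin_cases i
      · exact ⟨-1, fun x => by simp [ρ, Equiv.Perm.inv_def]⟩
      · exact ⟨0, fun x => by
          rw [_root_.map_inv, Equiv.Perm.inv_eq_iff_eq]
          simp only [ρ, FreeGroup.lift_apply_of]
          simp
          field_simp⟩
    | mul a b ha hb =>
      obtain ⟨p, hp⟩ := ha
      obtain ⟨q, hq⟩ := hb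
      refine ⟨(2 : ℚ) ^ Multiplicative.toAdd
        (FreeGroup.lift ![1, Multiplicative.ofAdd (1 : ℤ)] a) * q + p, fun x => ?_⟩
      rw [_root_.map_mul, Equiv.Perm.mul_apply, hq, hp, _root_.map_mul, toAdd_mul,
        zpow_add₀ two_ne_zero]
      ring
  have hpow : ∀ x, ρ (FreeGroup.of 0 ^ m) x = x + m := by
    intro x
    simp [ρ]
  intro hcomm
  obtain ⟨b, hb⟩ := hρ v
  have h := Equiv.congr_fun (congrArg ρ hcomm.eq) 0
  rw [_root_.map_mul, _root_.map_mul, Equiv.Perm.mul_apply, Equiv.Perm.mul_apply, hpow, hpow, hb,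
    hb] at h
  have h1 : (2 : ℚ) ^ Multiplicative.toAdd
      (FreeGroup.lift ![1, Multiplicative.ofAdd (1 : ℤ)] v) = 2 ^ (0 : ℤ) := by
    have hm' : (m : ℚ) ≠ 0 := by exact_mod_cast hm
    apply mul_right_cancel₀ hm'
    rw [zpow_zero]
    linarith
  exact hv (zpow_right_injective₀ (by norm_num) (by norm_num) h1)

namespace ActionCocycle

variable {G P : Type*} [Group G] [MulAction G P]

/-- The cyclic cover of `P` of degree `s` defined by an integral cocycle. -/
abbrev CyclicCover (χ : ActionCocycle G P (Multiplicative ℤ)) (s : ℕ) :=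
  (χ.map (AddMonoidHom.toMultiplicative (Int.castAddHom (ZMod s)))).SkewProduct

namespace CyclicCover

variable (χ : ActionCocycle G P (Multiplicative ℤ)) (s : ℕ)

/-- Points of the cyclic cover, in coordinates. -/
def equivProd : P × ZMod s ≃ χ.CyclicCover s :=
  Equiv.prodCongr (Equiv.refl P) Multiplicative.ofAdd

theorem smul_equivProd (g : G) (x : P) (j : ZMod s) :
    g • equivProd χ s (x, j) =
      equivProd χ s (g • x, j + (Multiplicative.toAdd (χ g x) : ℤ)) := by
  rw [add_comm]
  rfl

instance [Finite P] [NeZero s] : Finite (χ.CyclicCover s) := Finite.of_equiv _ (equivProd χ s)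

theorem smul_equivProd_eq_self_iff {g : G} {x : P} (j : ZMod s) :
    g • equivProd χ s (x, j) = equivProd χ s (x, j) ↔
      g • x = x ∧ ((Multiplicative.toAdd (χ g x) : ℤ) : ZMod s) = 0 := by
  rw [smul_equivProd, (equivProd χ s).injective.eq_iff, Prod.ext_iff]
  simp

/-- The cocycle counting how often an element winds around the cyclic cover. -/
def winding [NeZero s] : ActionCocycle G (χ.CyclicCover s) (Multiplicative ℤ) where
  toFun g y := Multiplicative.ofAdd
    ((((equivProd χ s).symm y).2.val +
      Multiplicative.toAdd (χ g ((equivProd χ s).symm y).1)) / (s : ℤ))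
  map_mul' g h y := by
    obtain ⟨⟨x, j⟩, rfl⟩ := (equivProd χ s).surjective y
    have hs : (s : ℤ) ≠ 0 := by exact_mod_cast NeZero.ne s
    rw [smul_equivProd]
    simp only [Equiv.symm_apply_apply, χ.map_mul, toAdd_mul, ← ofAdd_add]
    set a : ℤ := j.val + Multiplicative.toAdd (χ h x) with ha
    have hval : ((j + (Multiplicative.toAdd (χ h x) : ℤ)).val : ℤ) = a % s := by
      rw [← ZMod.val_intCast, ha]
      simp
    rw [hval, ← Int.add_mul_ediv_right _ _ hs]
    congr 2
    have := Int.emod_add_mul_ediv a s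
    linarith

theorem winding_equivProd [NeZero s] (g : G) (x : P) (j : ZMod s) :
    winding χ s g (equivProd χ s (x, j)) =
      Multiplicative.ofAdd ((j.val + Multiplicative.toAdd (χ g x)) / (s : ℤ)) := by
  simp [winding]

/-- The residues modulo `s` of the integers of absolute value at most `R`. -/
noncomputable def near (R : ℕ) : Finset (ZMod s) := (Finset.Icc (-(R : ℤ)) R).image Int.cast

variable {s}

theorem mem_near {R : ℕ} {j : ZMod s} : j ∈ near s R ↔ ∃ d : ℤ, |d| ≤ R ∧ (d : ZMod s) = j := by
  simp [near, abs_le]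

theorem card_near_le (R : ℕ) : (near s R).card ≤ 2 * R + 1 := by
  refine Finset.card_image_le.trans ?_
  rw [Int.card_Icc]
  omega

theorem add_mem_near {R K : ℕ} {j : ZMod s} (hj : j ∈ near s R) {d : ℤ} (hd : |d| ≤ K) :
    j + d ∈ near s (R + K) := by
  obtain ⟨e, he, rfl⟩ := mem_near.mp hj
  exact mem_near.mpr ⟨e + d, (abs_add_le e d).trans (by push_cast; omega), by simp⟩

theorem near_mono {R K : ℕ} (h : R ≤ K) : near s R ⊆ near s K := by
  intro j hj
  obtain ⟨e, he, rfl⟩ := mem_near.mp hj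
  exact mem_near.mpr ⟨e, by omega, rfl⟩

theorem winding_eq_one [NeZero s] {K : ℕ} {g : G} {x : P} {j : ZMod s}
    (hK : |Multiplicative.toAdd (χ g x)| ≤ K) (hj : j ∉ near s K) :
    winding χ s g (equivProd χ s (x, j)) = 1 := by
  rw [winding_equivProd, ← ofAdd_zero]
  congr 1
  have hlt := ZMod.val_lt j
  rw [abs_le] at hK
  apply Int.ediv_eq_zero_of_lt
  · by_contra! hneg
    exact hj (mem_near.mpr ⟨j.val, by rw [abs_le]; omega, by simp⟩)
  · by_contra! hge
    exact hj (mem_near.mpr ⟨j.val - s, by rw [abs_le]; omega, by simp⟩)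

end CyclicCover

open CyclicCover

/-- The value of a cocycle on a cyclic cover at a given group element only depends on the values
of the generators within a bounded distance. -/
theorem exists_locality_bound {A P ι : Type*} [Group A] [MulAction (FreeGroup ι) P] [Finite P]
    (χ : ActionCocycle (FreeGroup ι) P (Multiplicative ℤ)) (g : FreeGroup ι) :
    ∃ K : ℕ, (∀ x, |Multiplicative.toAdd (χ g x)| ≤ K) ∧
      ∀ (s : ℕ) (c : ActionCocycle (FreeGroup ι) (χ.CyclicCover s) A) (T : Subgroup A)
        (S : Set (ZMod s)), (∀ i x, ∀ j ∈ S, c (FreeGroup.of i) (equivProd χ s (x, j)) ∈ T) →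
        ∀ x (j : ZMod s), (∀ d : ℤ, |d| ≤ K → j + d ∈ S) → c g (equivProd χ s (x, j)) ∈ T := by
  induction g using FreeGroup.induction_on with
  | C1 => exact ⟨0, fun x => by simp [χ.map_one], fun s c T S _ x j _ => by
      rw [c.map_one]; exact one_mem T⟩
  | of i =>
    obtain ⟨K, hK⟩ := (Set.finite_range fun x =>
      (Multiplicative.toAdd (χ (FreeGroup.of i) x)).natAbs).bddAbove
    refine ⟨K, fun x => ?_, fun s c T S hS x j hj => hS i x j ?_⟩
    · have := hK ⟨x, rfl⟩
      rw [Int.abs_eq_natAbs]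
      exact_mod_cast this
    · simpa using hj 0 (by simp)
  | inv_of i ih =>
    obtain ⟨K, hK, h⟩ := ih
    refine ⟨K + K, fun x => ?_, fun s c T S hS x j hj => ?_⟩
    · rw [χ.map_inv, toAdd_inv, abs_neg]
      exact (hK _).trans (by omega)
    · rw [c.map_inv, smul_equivProd]
      refine inv_mem (h s c T S hS _ _ fun d hd => ?_)
      rw [add_assoc, ← Int.cast_add]
      refine hj _ ((abs_add_le _ _).trans ?_)
      rw [χ.map_inv, toAdd_inv, abs_neg]
      have := hK ((FreeGroup.of i)⁻¹ • x)
      push_cast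
      omega
  | mul a b ha hb =>
    obtain ⟨K, hK, h⟩ := ha
    obtain ⟨L, hL, h'⟩ := hb
    refine ⟨K + L, fun x => ?_, fun s c T S hS x j hj => ?_⟩
    · rw [χ.map_mul, toAdd_mul]
      refine (abs_add_le _ _).trans ?_
      have := hK (b • x)
      have := hL x
      push_cast
      omega
    · rw [c.map_mul, smul_equivProd]
      refine mul_mem (h s c T S hS _ _ fun d hd => ?_) (h' s c T S hS _ _ fun d hd =>
        hj d (hd.trans (by push_cast; omega)))
      rw [add_assoc, ← Int.cast_add]
      refine hj _ ((abs_add_le _ _).trans ?_)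
      have := hL x
      push_cast
      omega

end ActionCocycle

end CyclicCovers

section FreeCovers

open ActionCocycle CyclicCover

theorem ActionCocycle.exists_cocycle_not_commute {P κ : Type*} [MulAction (FreeGroup (Fin 2)) P]
    [MulAction.IsPretransitive (FreeGroup (Fin 2)) P] [Finite P] [Fintype κ]
    (χ : ActionCocycle (FreeGroup (Fin 2)) P (Multiplicative ℤ)) (w : κ → FreeGroup (Fin 2))
    (n : ℕ) (hn : ∀ k (x : P), w k ^ n • x = x)
    (hw : ∀ k (x : P) j, 1 ≤ j → j ≤ Fintype.card κ → w k ^ j • x ≠ x)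
    (hχ : ∀ k x, χ (w k ^ n) x = 1)
    {h₀ : FreeGroup (Fin 2)} {x₀ : P} (hx₀ : h₀ • x₀ = x₀) (hh₀ : χ h₀ x₀ ≠ 1) :
    ∃ (s : ℕ) (_ : NeZero s)
      (c : ActionCocycle (FreeGroup (Fin 2)) (χ.CyclicCover s) (FreeGroup (Fin 2))),
      (∀ k, w k ^ n ∈ c.ker) ∧ ∃ y, ∃ a b : MulAction.stabilizer (FreeGroup (Fin 2)) y,
        ¬ Commute (c.stabilizerHom y a) (c.stabilizerHom y b) := by
  classical
  have := Fintype.ofFinite P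
  choose L _ hL using fun k => χ.exists_locality_bound (A := FreeGroup (Fin 2)) (w k ^ n)
  choose M hM _ using fun i => χ.exists_locality_bound (A := FreeGroup (Fin 2)) (FreeGroup.of i)
  let K₀ := ∑ i, M i
  let K := ∑ k, L k
  have hK₀ : ∀ i x, |Multiplicative.toAdd (χ (FreeGroup.of i) x)| ≤ K₀ := fun i x =>
    (hM i x).trans (by
      exact_mod_cast Finset.single_le_sum_of_canonicallyOrdered (Finset.mem_univ i))
  have hK : ∀ k, L k ≤ K := fun k =>
    Finset.single_le_sum_of_canonicallyOrdered (Finset.mem_univ k)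
  let R := K₀ + K + K
  let s := 2 * (Fintype.card κ + 1) * (2 * R + 1) + 1
  have : Fintype (χ.CyclicCover s) := Fintype.ofFinite _
  let B : Finset (χ.CyclicCover s) :=
    (Finset.univ ×ˢ near s R).map (equivProd χ s).toEmbedding
  have hB : ∀ x j, equivProd χ s (x, j) ∈ B ↔ j ∈ near s R := by
    intro x j
    simp [B]
  have hcardB : 2 * (Fintype.card κ + 1) * B.card < Fintype.card (χ.CyclicCover s) := by
    have hP : 0 < Fintype.card P := Fintype.card_pos_iff.mpr ⟨x₀⟩
    rw [← Fintype.card_congr (equivProd χ s), Fintype.card_prod, ZMod.card, Finset.card_map,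
      Finset.card_product, Finset.card_univ]
    calc 2 * (Fintype.card κ + 1) * (Fintype.card P * (near s R).card)
        = Fintype.card P * (2 * (Fintype.card κ + 1) * (near s R).card) := by ring
      _ < Fintype.card P * s := by
        apply Nat.mul_lt_mul_of_pos_left _ hP
        exact Nat.lt_succ_of_le (Nat.mul_le_mul_left _ (card_near_le R))
  obtain ⟨α, hα, hαB, hflow, hαw⟩ := exists_flow (X := χ.CyclicCover s) w n
    (fun k y => by
      obtain ⟨⟨x, j⟩, rfl⟩ := (equivProd χ s).surjective y
      rw [smul_equivProd_eq_self_iff, hχ]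
      exact ⟨hn k x, by simp⟩)
    (fun k y j h1 h2 h => by
      obtain ⟨⟨x, i⟩, rfl⟩ := (equivProd χ s).surjective y
      exact hw k x j h1 h2 ((smul_equivProd_eq_self_iff χ s i).mp h).1) B hcardB
  let τ := winding χ s
  obtain ⟨c, hc⟩ := exists_apply_of_eq (ι := Fin 2) (X := χ.CyclicCover s) fun i y =>
    (FreeGroup.of 0 : FreeGroup (Fin 2)) ^ α (i, y) *
      FreeGroup.of 1 ^ Multiplicative.toAdd (τ (FreeGroup.of i) y)
  have hcu : ∀ i x j, j ∉ near s K₀ →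
      c (FreeGroup.of i) (equivProd χ s (x, j)) =
        FreeGroup.of 0 ^ α (i, equivProd χ s (x, j)) := by
    intro i x j hj
    rw [hc, winding_eq_one χ (hK₀ i x) hj, toAdd_one, zpow_zero, mul_one]
  have hct : ∀ i x j, j ∈ near s R →
      c (FreeGroup.of i) (equivProd χ s (x, j)) =
        FreeGroup.of 1 ^ Multiplicative.toAdd (τ (FreeGroup.of i) (equivProd χ s (x, j))) := by
    intro i x j hj
    rw [hc, hαB i _ ((hB x j).mpr hj), zpow_zero, one_mul]
  let πu : FreeGroup (Fin 2) →* Multiplicative ℤ :=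
    FreeGroup.lift ![Multiplicative.ofAdd (1 : ℤ), 1]
  let πt : FreeGroup (Fin 2) →* Multiplicative ℤ :=
    FreeGroup.lift ![1, Multiplicative.ofAdd (1 : ℤ)]
  have hπu : ∀ k y, πu (c (w k ^ n) y) = 1 := by
    refine hαw (c.map πu) fun i y => ?_
    rw [map_apply, hc]
    simp [πu, ← ofAdd_zsmul]
  have hπt : ∀ g y, πt (c g y) = τ g y := by
    refine eq_of_apply_of_eq (c := c.map πt) fun i y => ?_
    rw [map_apply, hc]
    simp [πt, ← ofAdd_zsmul]
  have hcw : ∀ k y, c (w k ^ n) y = 1 := by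
    intro k y
    obtain ⟨⟨x, j⟩, rfl⟩ := (equivProd χ s).surjective y
    by_cases hj : ∀ d : ℤ, |d| ≤ L k → j + d ∉ near s K₀
    · obtain ⟨m, hm⟩ := hL k s c (Subgroup.zpowers (FreeGroup.of 0)) {j | j ∉ near s K₀}
        (fun i x j hj => by
          rw [hcu i x j hj]
          exact Subgroup.zpow_mem_zpowers _ _) x j hj
      have h1 := hπu k (equivProd χ s (x, j))
      rw [← hm] at h1 ⊢
      have h2 : m = 0 := by simpa [πu, ← ofAdd_zsmul] using h1
      rw [h2]
      exact zpow_zero _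
    · push Not at hj
      obtain ⟨d, hd, hj⟩ := hj
      have hjK : j ∈ near s (K₀ + K) := by
        have h1 := add_mem_near (d := -d) (K := L k) hj (by rwa [abs_neg])
        rw [Int.cast_neg, add_neg_cancel_right] at h1
        exact near_mono (by have := hK k; omega) h1
      obtain ⟨m, hm⟩ := hL k s c (Subgroup.zpowers (FreeGroup.of 1)) {j | j ∈ near s R}
        (fun i x j hj => by
          rw [hct i x j hj]
          exact Subgroup.zpow_mem_zpowers _ _) x j
        (fun d hd => add_mem_near hjK (hd.trans (by exact_mod_cast hK k)))
      have h1 := hπt (w k ^ n) (equivProd χ s (x, j))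
      have h3 : τ (w k ^ n) (equivProd χ s (x, j)) = 1 := by
        rw [winding_equivProd, hχ, toAdd_one, add_zero, Int.ediv_eq_zero_of_lt
          (Int.natCast_nonneg _) (by exact_mod_cast ZMod.val_lt j), ofAdd_zero]
      rw [h3, ← hm] at h1
      rw [← hm]
      have h2 : m = 0 := by simpa [πt, ← ofAdd_zsmul] using h1
      rw [h2]
      exact zpow_zero _
  obtain ⟨g, y, m, hm, hgy, hcg⟩ := c.exists_loop_of_flow (FreeGroup.of 0) α hα hflow
    (fun i y hy => by
      obtain ⟨⟨x, j⟩, rfl⟩ := (equivProd χ s).surjective y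
      refine hcu i x j fun hj => hy (hαB i _ ((hB x j).mpr (near_mono ?_ hj)))
      omega)
  refine ⟨s, inferInstance, c, fun k => c.mem_ker_iff.mpr fun y => ⟨?_, hcw k y⟩, y, ⟨g, hgy⟩, ?_⟩
  · obtain ⟨⟨x, j⟩, rfl⟩ := (equivProd χ s).surjective y
    rw [smul_equivProd_eq_self_iff, hχ]
    exact ⟨hn k x, by simp⟩
  · obtain ⟨⟨x, j⟩, rfl⟩ := (equivProd χ s).surjective y
    obtain ⟨p, rfl⟩ := MulAction.exists_smul_eq (FreeGroup (Fin 2)) x₀ x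
    have hfix : (p * h₀ * p⁻¹) • p • x₀ = p • x₀ := by
      rw [mul_smul, inv_smul_smul, mul_smul, hx₀]
    have hval : χ ((p * h₀ * p⁻¹) ^ s) (p • x₀) = χ h₀ x₀ ^ s := by
      rw [χ.map_pow_of_smul_eq hfix, χ.map_conj_of_smul_eq hx₀, mul_right_comm, mul_inv_cancel,
        one_mul]
    have hfix' : (p * h₀ * p⁻¹) ^ s • p • x₀ = p • x₀ :=
      MulAction.mem_stabilizer_iff.mp
        (pow_mem (MulAction.mem_stabilizer_iff.mpr hfix) s)
    refine ⟨⟨(p * h₀ * p⁻¹) ^ s, ?_⟩, ?_⟩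
    · rw [MulAction.mem_stabilizer_iff, smul_equivProd_eq_self_iff, hval]
      exact ⟨hfix', by simp⟩
    · change ¬ Commute (c g _) (c ((p * h₀ * p⁻¹) ^ s) _)
      rw [hcg]
      refine FreeGroup.not_commute_of_zpow hm fun h => hh₀ ?_
      have h1 := (hπt _ _).symm.trans h
      rw [winding_equivProd, hval, toAdd_pow, nsmul_eq_mul, Int.add_mul_ediv_left _ _
        (by exact_mod_cast NeZero.ne s), Int.ediv_eq_zero_of_lt (Int.natCast_nonneg _)
          (by exact_mod_cast ZMod.val_lt j), zero_add, ofAdd_toAdd] at h1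
      exact h1

theorem FreeGroup.exists_normal_pow_mem_stabilizer_hom {κ : Type*} [Finite κ]
    (w : κ → FreeGroup (Fin 2)) :
    ∃ n₀, ∀ n ≥ n₀, ∃ (M K : Subgroup (FreeGroup (Fin 2))) (_ : M.Normal) (_ : K.FiniteIndex)
      (ψ : K →* FreeGroup (Fin 2)) (a b : K), (∀ x : K, (x : FreeGroup (Fin 2)) ∈ M → ψ x = 1) ∧
      ¬ Commute (ψ a) (ψ b) ∧ ∀ k, w k ^ n ∈ M := by
  classical
  have := Fintype.ofFinite κ
  let κ' := {k // w k ≠ 1}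
  let r := Fintype.card κ'
  obtain ⟨n₀, hn₀⟩ := FreeGroup.exists_normal_pow_mem_forall_notMem
    (Finset.image (fun p : κ' × ℕ => w p.1 ^ p.2) (Finset.univ ×ˢ Finset.Icc 1 r)) (by
      simp only [Finset.mem_image, Finset.mem_product, Finset.mem_univ, true_and, Finset.mem_Icc,
        not_exists, not_and, Prod.forall]
      rintro ⟨k, hk⟩ j ⟨hj, -⟩ h
      rw [pow_eq_one_iff_left (by omega)] at h
      exact hk h)
  refine ⟨n₀, fun n hn => ?_⟩
  obtain ⟨N, hN, hNfin, hpow, hnot⟩ := hn₀ n hn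
  let F := FreeGroup (Fin 2)
  have : Fintype (F ⧸ N) := Fintype.ofFinite _
  have hsmul : ∀ (g : F) (x : F ⧸ N), g • x = x ↔ g ∈ N := by
    intro g x
    obtain ⟨h, rfl⟩ := QuotientGroup.mk_surjective x
    rw [MulAction.Quotient.smul_mk, eq_comm, QuotientGroup.eq, smul_eq_mul, ← mul_assoc,
      hN.mem_comm_iff, mul_inv_cancel_left]
  have hn' : ∀ (k : κ') (x : F ⧸ N), w k ^ n • x = x := fun k x => (hsmul _ _).mpr (hpow _)
  have hw' : ∀ (k : κ') (x : F ⧸ N) j, 1 ≤ j → j ≤ r → w k ^ j • x ≠ x := by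
    intro k x j h1 h2 h
    refine hnot _ (Finset.mem_image.mpr ⟨(k, j), ?_, rfl⟩) ((hsmul _ _).mp h)
    simp [h1, h2]
  obtain ⟨α, hα, -, hflow, hαw⟩ := exists_flow (X := F ⧸ N) (fun k : κ' => w k) n hn' hw' ∅
    (by simpa using Fintype.card_pos)
  obtain ⟨χ, hχ⟩ := exists_apply_of_eq (ι := Fin 2) (X := F ⧸ N) fun i x =>
    Multiplicative.ofAdd (α (i, x))
  obtain ⟨h₀, x₀, m, hm, hx₀, hh₀⟩ := χ.exists_loop_of_flow (Multiplicative.ofAdd 1) α hα hflow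
    (fun i x _ => by rw [hχ, ← ofAdd_zsmul, smul_eq_mul, mul_one])
  obtain ⟨s, hs, c, hcw, y, a, b, hab⟩ := χ.exists_cocycle_not_commute (fun k : κ' => w k) n hn'
    hw' (hαw χ hχ) hx₀ (by rw [hh₀, ← ofAdd_zsmul]; simpa using hm)
  refine ⟨c.ker, MulAction.stabilizer _ y, inferInstance, ⟨?_⟩, c.stabilizerHom y, a, b,
    fun x hx => (c.mem_ker_iff.mp hx y).2, hab, fun k => ?_⟩
  · rw [MulAction.index_stabilizer]
    have := (Set.toFinite (MulAction.orbit (FreeGroup (Fin 2)) y))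
    exact (Set.ncard_pos this |>.mpr (MulAction.nonempty_orbit y)).ne'
  · by_cases hk : w k = 1
    · rw [hk, one_pow]
      exact one_mem _
    · exact hcw ⟨k, hk⟩

end FreeCovers

/-- Lackenby: Let G be large, H a finite index normal subgroup of G
surjecting onto a noncyclic free group, and g₁,…,g_k ∈ H. Then G/⟪g₁ⁿ,…,g_kⁿ⟫^G is large
for all but finitely many n ∈ ℕ. -/
theorem stmt_11 {G : Type*} [Group G] (hG : IsLarge G) (H : Subgroup G) [H.Normal]
    (hfin : H.FiniteIndex) (φ : H →* FreeGroup (Fin 2)) (hφ : Function.Surjective φ)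
    (k : ℕ) (g : Fin k → G) (hg : ∀ i, g i ∈ H) :
    {n : ℕ | ¬ IsLarge (G ⧸ Subgroup.normalClosure {x | ∃ i : Fin k, x = (g i) ^ n})}.Finite := by
  have : Finite (G ⧸ H) := Subgroup.finite_quotient_of_finiteIndex
  obtain ⟨n₀, hn₀⟩ := FreeGroup.exists_normal_pow_mem_stabilizer_hom
    fun p : Fin k × (G ⧸ H) => φ (MulAut.conjNormal p.2.out ⟨g p.1, hg p.1⟩)
  refine (Set.finite_lt_nat n₀).subset fun n hn => ?_
  by_contra hlt
  obtain ⟨M, K, _, _, ψ, a, b, hψ, hab, hM⟩ := hn₀ n (not_lt.mp hlt)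
  exact hn (isLarge_quotient_normalClosure_pow H φ hφ (fun i => ⟨g i, hg i⟩) n M K ψ hψ hab
    fun i q => hM (i, q))
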